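/- Anisotropic Gagliardo–Sobolev–Nirenberg parabolic embedding: Let N > 2 be an integer, Ω ⊆ ℝ^N a rectangular domain, T > 0, and let α_1, …, α_N ≥ 1 with α := α_1 + … + α_N and 2*_α := (2N/(N−2))·(α/N). Let σ ∈ [1, 2*_α], θ ∈ [0, (N−2)/N], and set q := θ·2*_α + σ·(1−θ). Then there exists a constant c̃ > 0, depending only on N, α, θ, σ, such that for every function u : Ω × [0,T] → ℝ that is smooth and compactly supported in Ω at each time, and for which the right-hand side below is finite, ∬_{Ω×[0,T]} |u|^q dx dt ≤ c̃ · T^{1 − θN/(N−2)} · (sup_{t∈[0,T]} ∫_Ω |u(x,t)|^σ dx)^{1−θ} · ∏_{i=1}^N (∬_{Ω×[0,T]} |∂_{x_i}(|u|^{α_i})|² dx dt)^{θ/(N−2)}. -/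

import Mathlib

open MeasureTheory Set

lemma aux_LW (N : ℕ) (hN : 2 < N) (f : Fin N → (Fin N → ℝ) → ENNReal)
    (hf : ∀ i, Measurable (f i)) (hfin : ∀ i, ∫⁻ x, f i x ≠ ⊤) :
    ∫⁻ x, ∏ i, (∫⁻ t, f i (Function.update x i t)) ^ ((1:ℝ) / ((N:ℝ) - 1)) ≤
      (N : ENNReal) ^ ((N:ℝ)/((N:ℝ)-1)) * ∏ i, (∫⁻ x, f i x) ^ ((1:ℝ) / ((N:ℝ) - 1)) := by
  have hN' : (2:ℝ) < N := by exact_mod_cast hN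
  set r : ℝ := (1:ℝ) / ((N:ℝ) - 1) with hr
  set p : ℝ := (N:ℝ)/((N:ℝ)-1) with hp
  have hr0 : 0 < r := by rw [hr]; apply div_pos <;> linarith
  have hp0 : 0 < p := by rw [hp]; apply div_pos <;> linarith
  set L := ∫⁻ x, ∏ i, (∫⁻ t, f i (Function.update x i t)) ^ r with hL
  have key : ∀ ε : ENNReal, ε ≠ 0 → ε ≠ ⊤ →
      L ≤ (N : ENNReal) ^ p * ∏ i, ((∫⁻ x, f i x) + ε) ^ r := by
    intro ε h0 h1
    set l : Fin N → ENNReal := fun i => (∫⁻ x, f i x) + ε with hl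
    have hl0 : ∀ i, l i ≠ 0 := fun i => by simp [hl, h0]
    have hl1 : ∀ i, l i ≠ ⊤ := fun i => by simp [hl, h1, hfin i]
    have hmeas : Measurable (fun x => ∑ j, (l j)⁻¹ * f j x) :=
      Finset.measurable_sum _ fun j _ => (hf j).const_mul _
    have conj : Real.HolderConjugate (Fintype.card (Fin N)) p := by
      rw [Fintype.card_fin, Real.holderConjugate_iff]
      refine ⟨by linarith, ?_⟩
      rw [hp]; have : (N:ℝ) - 1 ≠ 0 := by linarith
      have : (N:ℝ) ≠ 0 := by linarith
      field_simp; ring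
    have G := lintegral_prod_lintegral_pow_le (fun _ : Fin N => (volume : Measure ℝ)) conj hmeas
    simp only [Fintype.card_fin] at G
    rw [← hr, ← volume_pi] at G
    have hsum : ∫⁻ x, ∑ j, (l j)⁻¹ * f j x ≤ N := by
      rw [lintegral_finsetSum _ fun j _ => (hf j).const_mul _]
      calc _ ≤ ∑ j : Fin N, (1 : ENNReal) := by
            apply Finset.sum_le_sum
            intro j _
            rw [lintegral_const_mul _ (hf j), mul_comm, ← div_eq_mul_inv]
            apply ENNReal.div_le_of_le_mul
            rw [one_mul]; exact le_self_add
        _ = N := by simp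
    have h2 : (∏ i, ((l i)⁻¹) ^ r) * L ≤ (N:ENNReal) ^ p := by
      refine le_trans ?_ (G.trans (ENNReal.rpow_le_rpow hsum hp0.le))
      rw [hL, ← lintegral_const_mul' _ _ (by
        apply ENNReal.prod_ne_top; intro i _
        exact ENNReal.rpow_ne_top_of_nonneg hr0.le (by simp [hl0 i]))]
      apply lintegral_mono
      intro x
      simp only
      rw [← Finset.prod_mul_distrib]
      gcongr with i
      rw [← ENNReal.mul_rpow_of_nonneg _ _ hr0.le]
      gcongr
      rw [← lintegral_const_mul' _ _ (by simp [hl0 i])]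
      apply lintegral_mono
      intro t
      exact Finset.single_le_sum (f := fun j => (l j)⁻¹ * f j (Function.update x i t))
        (fun _ _ => zero_le) (Finset.mem_univ i)
    have h3 : (∏ i, ((l i)⁻¹) ^ r) = (∏ i, (l i) ^ r)⁻¹ := by
      rw [ENNReal.prod_inv_distrib]
      · simp [ENNReal.inv_rpow]
      · intro i _ j _ _
        left; simp [hl0 i, hl1 i]
    rw [h3, mul_comm, ← div_eq_mul_inv] at h2
    rwa [ENNReal.div_le_iff] at h2
    · simp [Finset.prod_eq_zero_iff, hl0, hl1]
    · apply ENNReal.prod_ne_top; intro i _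
      exact ENNReal.rpow_ne_top_of_nonneg hr0.le (hl1 i)
  have lim : Filter.Tendsto (fun ε : ENNReal => (N : ENNReal) ^ p * ∏ i, ((∫⁻ x, f i x) + ε) ^ r)
      (nhdsWithin 0 (Ioi 0)) (nhds ((N : ENNReal) ^ p * ∏ i, ((∫⁻ x, f i x) + 0) ^ r)) := by
    apply tendsto_nhdsWithin_of_tendsto_nhds
    apply ENNReal.Tendsto.const_mul
    · apply ENNReal.tendsto_finsetProd_of_ne_top
      · intro i _
        exact (ENNReal.continuous_rpow_const.tendsto _).comp (tendsto_const_nhds.add Filter.tendsto_id)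
      · intro i _
        exact ENNReal.rpow_ne_top_of_nonneg hr0.le (by simp [hfin i])
    · right; exact ENNReal.rpow_ne_top_of_nonneg hp0.le (by simp)
  simp only [add_zero] at lim
  refine ge_of_tendsto lim ?_
  have : ∀ᶠ e : ENNReal in nhdsWithin 0 (Ioi 0), e < ⊤ :=
    nhdsWithin_le_nhds (Iio_mem_nhds (by simp))
  filter_upwards [this, self_mem_nhdsWithin] with e he he'
  exact key e (ne_of_gt he') he.ne

lemma aux_line (N : ℕ) (u : (Fin N → ℝ) → ℝ) (hu : ContDiff ℝ 1 u)
    (h2u : HasCompactSupport u) (x : Fin N → ℝ) (i : Fin N) :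
    ‖u x‖ₑ ≤ ∫⁻ t, ‖fderiv ℝ u (Function.update x i t) (Pi.single i 1)‖ₑ := by
  calc ‖u x‖ₑ
    _ ≤ ∫⁻ xᵢ in Iic (x i), ‖deriv (u ∘ Function.update x i) xᵢ‖ₑ := by
        apply le_trans (by simp) (HasCompactSupport.enorm_le_lintegral_Ici_deriv _ _ _)
        · exact hu.comp (by convert! contDiff_update 1 x i)
        · exact h2u.comp_isClosedEmbedding (isClosedEmbedding_update x i)
    _ ≤ ∫⁻ t, ‖fderiv ℝ u (Function.update x i t) (Pi.single i 1)‖ₑ := by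
      gcongr with y
      · exact Measure.restrict_le_self
      rw [fderiv_comp_deriv _ (hu.differentiable one_ne_zero).differentiableAt
          (hasDerivAt_update x i y).differentiableAt, deriv_update]

lemma aux_deriv (N : ℕ) (v : (Fin N → ℝ) → ℝ) (hv : ContDiff ℝ 1 v) (s al : ℝ)
    (hal : 1 ≤ al) (hs : al < s) (x e : Fin N → ℝ) :
    fderiv ℝ (fun y => |v y| ^ s) x e =
      (s / al) * |v x| ^ (s - al) * fderiv ℝ (fun y => |v y| ^ al) x e := by
  by_cases h : v x = 0
  · have : IsLocalMin (fun y => |v y| ^ s) x := by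
      apply Filter.Eventually.of_forall
      intro y
      simp only [h, abs_zero]
      rw [Real.zero_rpow (by linarith)]
      positivity
    rw [this.fderiv_eq_zero, h, abs_zero, Real.zero_rpow (by linarith)]
    simp
  · have hd : DifferentiableAt ℝ (fun y => |v y| ^ al) x := by
      apply DifferentiableAt.rpow_const
      · exact ((hv.differentiable one_ne_zero) x).abs h
      · left; simpa using h
    have e1 : (fun y => |v y| ^ s) = fun y => (|v y| ^ al) ^ (s / al) := by
      funext y
      rw [← Real.rpow_mul (abs_nonneg _)]
      congr 1; field_simp
    have hpos : 0 < |v x| := abs_pos.mpr h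
    have h2 := hd.hasFDerivAt.rpow_const (p := s / al) (Or.inl (by positivity))
    rw [e1, h2.fderiv]
    simp only [smul_apply, smul_eq_mul]
    rw [← Real.rpow_mul hpos.le]
    congr 3
    field_simp

lemma aux_cont (N : ℕ) (v : (Fin N → ℝ) → ℝ) (hv : Continuous v)
    (hc : HasCompactSupport v) (s : ℝ) (hs : 0 < s) :
    Integrable (fun x => |v x| ^ s) := by
  apply Continuous.integrable_of_hasCompactSupport
  · exact (hv.abs).rpow_const fun _ => Or.inr hs.le
  · exact hc.comp_left (g := fun z : ℝ => |z| ^ s) (by simp [Real.zero_rpow hs.ne'])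

lemma aux_slice (N : ℕ) (hN : 2 < N) (α : Fin N → ℝ) (hα : ∀ i, 1 ≤ α i) (Q : ℝ)
    (hQ : Q = 2 * (N : ℝ) / ((N : ℝ) - 2) * ((∑ j, α j) / (N : ℝ))) :
    ∃ C : ENNReal, C ≠ ⊤ ∧ ∀ v : (Fin N → ℝ) → ℝ, ContDiff ℝ 1 v → HasCompactSupport v →
      (∀ i, ∫⁻ x, ENNReal.ofReal ((fderiv ℝ (fun y => |v y| ^ (α i)) x (Pi.single i 1)) ^ 2) ≠ ⊤) →
      ∫⁻ x, ENNReal.ofReal (|v x| ^ Q) ≤ C * ∏ i, (∫⁻ x, ENNReal.ofReal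
        ((fderiv ℝ (fun y => |v y| ^ (α i)) x (Pi.single i 1)) ^ 2)) ^ (1 / ((N:ℝ) - 2)) := by
  have hN' : (2:ℝ) < N := by exact_mod_cast hN
  set r : ℝ := (1:ℝ) / ((N:ℝ) - 1) with hr
  have hr0 : 0 < r := by rw [hr]; apply div_pos <;> linarith
  have hA : (N:ℝ) ≤ ∑ j, α j := by
    calc (N:ℝ) = ∑ j : Fin N, (1:ℝ) := by simp
      _ ≤ _ := Finset.sum_le_sum fun i _ => hα i
  have hQ0 : 0 < Q := by
    rw [hQ]
    have : 0 < (N:ℝ) - 2 := by linarith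
    have : 0 < ∑ j, α j := by linarith
    positivity
  set s : Fin N → ℝ := fun i => α i + Q / 2 with hs
  have hsum : ∑ i, s i * r = Q := by
    rw [← Finset.sum_mul, hs, Finset.sum_add_distrib]
    simp only [Finset.sum_const, Finset.card_univ, Fintype.card_fin, nsmul_eq_mul]
    rw [hr, hQ]
    have h1 : (N:ℝ) - 1 ≠ 0 := by linarith
    have h2 : (N:ℝ) - 2 ≠ 0 := by linarith
    have h3 : (N:ℝ) ≠ 0 := by linarith
    field_simp
    ring
  set K : ENNReal := (N : ENNReal) ^ ((N:ℝ)/((N:ℝ)-1)) * ∏ i, ENNReal.ofReal (s i / α i) ^ r with hK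
  have hp0 : 0 < (N:ℝ)/((N:ℝ)-1) := by apply div_pos <;> linarith
  have hKt : K ≠ ⊤ := by
    apply ENNReal.mul_ne_top
    · exact ENNReal.rpow_ne_top_of_nonneg hp0.le (by simp)
    · exact ENNReal.prod_ne_top fun i _ => ENNReal.rpow_ne_top_of_nonneg hr0.le (by simp)
  set m : ℝ := 2 * ((N:ℝ) - 1) / ((N:ℝ) - 2) with hm
  have hm0 : 0 < m := by rw [hm]; apply div_pos <;> linarith
  refine ⟨K ^ m, ENNReal.rpow_ne_top_of_nonneg hm0.le hKt, ?_⟩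
  intro v hv hc hI
  set D : Fin N → (Fin N → ℝ) → ℝ :=
    fun i x => fderiv ℝ (fun y => |v y| ^ (α i)) x (Pi.single i 1) with hD
  have hDm : ∀ i, Measurable (D i) := fun i => measurable_fderiv_apply_const ℝ _ _
  set I : Fin N → ENNReal := fun i => ∫⁻ x, ENNReal.ofReal ((D i x) ^ 2) with hIdef
  change ∀ i, I i ≠ ⊤ at hI
  change _ ≤ K ^ m * ∏ i, I i ^ (1 / ((N:ℝ) - 2))
  set X := ∫⁻ x, ENNReal.ofReal (|v x| ^ Q) with hX
  have hXt : X ≠ ⊤ := (aux_cont N v hv.continuous hc Q hQ0).lintegral_lt_top.ne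
  set f : Fin N → (Fin N → ℝ) → ENNReal :=
    fun i x => ‖fderiv ℝ (fun y => |v y| ^ (s i)) x (Pi.single i 1)‖ₑ with hf
  have hfm : ∀ i, Measurable (f i) := fun i => (measurable_fderiv_apply_const ℝ _ _).enorm
  have hfle : ∀ i, ∫⁻ x, f i x ≤ ENNReal.ofReal (s i / α i) * (X ^ (1/2:ℝ) * I i ^ (1/2:ℝ)) := by
    intro i
    have hsi : 0 ≤ s i / α i := by
      have := hα i
      exact div_nonneg (by simp only [hs]; linarith) (by linarith)
    have e : ∀ x, f i x = ENNReal.ofReal (s i / α i) *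
        (ENNReal.ofReal (|v x| ^ Q) ^ (1/2:ℝ) * ENNReal.ofReal ((D i x) ^ 2) ^ (1/2:ℝ)) := by
      intro x
      simp only [hf]
      rw [aux_deriv N v hv (s i) (α i) (hα i) (by simp only [hs]; linarith)]
      rw [ENNReal.ofReal_rpow_of_nonneg (by positivity) (by norm_num),
        ENNReal.ofReal_rpow_of_nonneg (by positivity) (by norm_num),
        ← ENNReal.ofReal_mul (by positivity), ← ENNReal.ofReal_mul hsi,
        Real.enorm_eq_ofReal_abs, abs_mul, abs_mul, abs_of_nonneg hsi,
        abs_of_nonneg (by positivity : 0 ≤ |v x| ^ (s i - α i)), ← Real.rpow_mul (abs_nonneg _),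
        ← Real.sqrt_eq_rpow, Real.sqrt_sq_eq_abs, mul_assoc]
      simp only [hs, hD]
      congr 4
      ring_nf
    simp_rw [e]
    rw [lintegral_const_mul' _ _ (by simp)]
    gcongr
    apply ENNReal.lintegral_mul_norm_pow_le
    · exact (((hv.continuous.abs).rpow_const fun _ => Or.inr hQ0.le).measurable.ennreal_ofReal).aemeasurable
    · exact ((hDm i).pow_const 2).ennreal_ofReal.aemeasurable
    · norm_num
    · norm_num
    · norm_num
  have hffin : ∀ i, ∫⁻ x, f i x ≠ ⊤ := fun i => by
    refine ne_top_of_le_ne_top ?_ (hfle i)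
    apply ENNReal.mul_ne_top (by simp)
    exact ENNReal.mul_ne_top (ENNReal.rpow_ne_top_of_nonneg (by norm_num) hXt)
      (ENNReal.rpow_ne_top_of_nonneg (by norm_num) (hI i))
  have main : X ≤ K * (X ^ ((N:ℝ) * r / 2) * ∏ i, I i ^ (r / 2)) := by
    calc X ≤ ∫⁻ x, ∏ i, (∫⁻ t, f i (Function.update x i t)) ^ r := by
          apply lintegral_mono
          intro x
          have : ENNReal.ofReal (|v x| ^ Q) = ∏ i, ‖|v x| ^ (s i)‖ₑ ^ r := by
            have h0 : ∀ i, 0 ≤ s i * r := fun i => by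
              have := hα i
              apply mul_nonneg _ hr0.le
              simp only [hs]; linarith
            rw [← hsum, Real.rpow_sum_of_nonneg (abs_nonneg _) (fun i _ => h0 i),
              ENNReal.ofReal_prod_of_nonneg (fun i _ => by positivity)]
            apply Finset.prod_congr rfl
            intro i _
            rw [Real.enorm_eq_ofReal (by positivity),
              ENNReal.ofReal_rpow_of_nonneg (by positivity) hr0.le, Real.rpow_mul (abs_nonneg _)]
          simp only
          rw [this]
          gcongr with i
          have hsi : 1 < s i := by have := hα i; simp only [hs]; linarith
          apply aux_line N (fun y => |v y| ^ (s i))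
          · exact hv.norm_rpow hsi
          · exact hc.comp_left (g := fun z : ℝ => |z| ^ (s i))
              (by simp [Real.zero_rpow (by linarith : s i ≠ 0)])
      _ ≤ _ := aux_LW N hN f hfm hffin
      _ ≤ (N : ENNReal) ^ ((N:ℝ)/((N:ℝ)-1)) *
          ∏ i, (ENNReal.ofReal (s i / α i) * (X ^ (1/2:ℝ) * I i ^ (1/2:ℝ))) ^ r := by
        gcongr with i
        exact hfle i
      _ = _ := by
        simp_rw [ENNReal.mul_rpow_of_nonneg _ _ hr0.le, Finset.prod_mul_distrib, ← ENNReal.rpow_mul]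
        rw [hK, mul_assoc]
        congr 3
        · rw [Finset.prod_const, Finset.card_univ, Fintype.card_fin, ← ENNReal.rpow_natCast,
            ← ENNReal.rpow_mul]
          congr 1; ring
        · apply Finset.prod_congr rfl; intro i _; congr 1; ring
  by_cases hX0 : X = 0
  · rw [hX0]; exact zero_le
  have h1 : X ^ (1 / m) ≤ K * ∏ i, I i ^ (r / 2) := by
    have e1 : X ^ (1/m) = X * (X ^ ((N:ℝ) * r / 2))⁻¹ := by
      rw [← ENNReal.rpow_neg]
      nth_rw 2 [← ENNReal.rpow_one X]
      rw [← ENNReal.rpow_add _ _ hX0 hXt]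
      congr 1
      rw [hm, hr]
      have h1 : (N:ℝ) - 1 ≠ 0 := by linarith
      have h2 : (N:ℝ) - 2 ≠ 0 := by linarith
      field_simp
      ring
    rw [e1, ← div_eq_mul_inv]
    apply ENNReal.div_le_of_le_mul
    calc X ≤ _ := main
      _ = _ := by ring
  calc X = (X ^ (1/m)) ^ m := by
        rw [← ENNReal.rpow_mul, one_div_mul_cancel hm0.ne', ENNReal.rpow_one]
    _ ≤ (K * ∏ i, I i ^ (r / 2)) ^ m := ENNReal.rpow_le_rpow h1 hm0.le
    _ = _ := by
      rw [ENNReal.mul_rpow_of_nonneg _ _ hm0.le, ← ENNReal.prod_rpow_of_nonneg hm0.le]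
      congr 1
      apply Finset.prod_congr rfl; intro i _
      rw [← ENNReal.rpow_mul]
      congr 1
      rw [hm, hr]
      have h1 : (N:ℝ) - 1 ≠ 0 := by linarith
      have h2 : (N:ℝ) - 2 ≠ 0 := by linarith
      field_simp

/-- **Anisotropic Gagliardo–Sobolev–Nirenberg parabolic embedding**
(Proposition 2.2 of the paper, L² case).  Let `N > 2`, `α_i ≥ 1` with sum `A`,
`2*_α = (2N/(N−2))(A/N)`, `σ ∈ [1, 2*_α]`, `θ ∈ [0, (N−2)/N]`, and
`q = θ·2*_α + σ(1−θ)`.  There is `c̃ > 0`, depending only on `N, A, θ, σ`, such that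
for every rectangular `Ω`, every `T > 0` and every `u` smooth and compactly supported
in `Ω` at each time for which the right-hand side is finite,
`∬_{Ω×[0,T]} |u|^q ≤ c̃ T^{1−θN/(N−2)} (sup_t ∫_Ω |u|^σ)^{1−θ}
  ∏_i (∬_{Ω×[0,T]} |∂_{x_i}(|u|^{α_i})|²)^{θ/(N−2)}`. -/
theorem anisotropic_gagliardo_sobolev_nirenberg (N : ℕ) (hN : 2 < N)
    (α : Fin N → ℝ) (hα : ∀ i, 1 ≤ α i)
    (σ θ : ℝ)
    (hσ : σ ∈ Icc 1 (2 * (N : ℝ) / ((N : ℝ) - 2) * ((∑ j, α j) / (N : ℝ))))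
    (hθ : θ ∈ Icc (0 : ℝ) (((N : ℝ) - 2) / (N : ℝ))) :
    ∃ c : ℝ, 0 < c ∧
      ∀ a b : Fin N → ℝ, ∀ T : ℝ, 0 < T →
        ∀ u : (Fin N → ℝ) → ℝ → ℝ,
        (∀ t ∈ Icc (0 : ℝ) T, ContDiff ℝ (⊤ : ℕ∞) (fun x => u x t) ∧
          HasCompactSupport (fun x => u x t) ∧
          tsupport (fun x => u x t) ⊆ Set.univ.pi (fun i => Ioo (a i) (b i))) →
        BddAbove ((fun t => ∫ x in Set.univ.pi (fun i => Ioo (a i) (b i)),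
            |u x t| ^ σ) '' Icc (0 : ℝ) T) →
        (∀ i, IntegrableOn
          (fun p : (Fin N → ℝ) × ℝ =>
            (fderiv ℝ (fun y => |u y p.2| ^ (α i)) p.1 (Pi.single i 1)) ^ 2)
          ((Set.univ.pi (fun i => Ioo (a i) (b i))) ×ˢ Icc (0 : ℝ) T)) →
        (∫ p in (Set.univ.pi (fun i => Ioo (a i) (b i))) ×ˢ Icc (0 : ℝ) T,
            |u p.1 p.2| ^ (θ * (2 * (N : ℝ) / ((N : ℝ) - 2) * ((∑ j, α j) / (N : ℝ)))
              + σ * (1 - θ))) ≤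
          c * T ^ (1 - θ * (N : ℝ) / ((N : ℝ) - 2)) *
            (sSup ((fun t => ∫ x in Set.univ.pi (fun i => Ioo (a i) (b i)),
                |u x t| ^ σ) '' Icc (0 : ℝ) T)) ^ (1 - θ) *
            ∏ i, (∫ p in (Set.univ.pi (fun i => Ioo (a i) (b i))) ×ˢ Icc (0 : ℝ) T,
                (fderiv ℝ (fun y => |u y p.2| ^ (α i)) p.1 (Pi.single i 1)) ^ 2) ^
              (θ / ((N : ℝ) - 2)) := by
  have hN' : (2:ℝ) < N := by exact_mod_cast hN
  have hN2 : (0:ℝ) < (N:ℝ) - 2 := by linarith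
  have hN0 : (0:ℝ) < (N:ℝ) := by linarith
  obtain ⟨hσ1, -⟩ := hσ
  obtain ⟨hθ0, hθ2⟩ := hθ
  have hθ3 : θ * N ≤ N - 2 := by rwa [le_div_iff₀ hN0] at hθ2
  have hθ1 : θ < 1 := by
    by_contra h
    push Not at h
    nlinarith
  set Q : ℝ := 2 * (N : ℝ) / ((N : ℝ) - 2) * ((∑ j, α j) / (N : ℝ)) with hQ
  have hA : (N:ℝ) ≤ ∑ j, α j := by
    calc (N:ℝ) = ∑ j : Fin N, (1:ℝ) := by simp
      _ ≤ _ := Finset.sum_le_sum fun i _ => hα i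
  have hQ0 : 0 < Q := by
    rw [hQ]
    have : 0 < ∑ j, α j := by linarith
    positivity
  obtain ⟨C, hC, hslice⟩ := aux_slice N hN α hα Q hQ
  set r : ℝ := θ / ((N:ℝ) - 2) with hr
  have hr0 : 0 ≤ r := div_nonneg hθ0 hN2.le
  set k : ℝ := 1 - θ * (N : ℝ) / ((N : ℝ) - 2) with hk
  have hk0 : 0 ≤ k := by
    rw [hk, sub_nonneg, div_le_one hN2]; exact hθ3
  have hCθ : C ^ θ ≠ ⊤ := ENNReal.rpow_ne_top_of_nonneg hθ0 hC
  refine ⟨(C ^ θ).toReal + 1, by positivity, ?_⟩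
  intro a b T hT u hu hbdd hint
  set B : Set (Fin N → ℝ) := Set.univ.pi (fun i => Ioo (a i) (b i)) with hB
  set q : ℝ := θ * Q + σ * (1 - θ) with hq
  have hq0 : 0 < q := by
    have : 0 < σ * (1 - θ) := by apply mul_pos <;> linarith
    have : 0 ≤ θ * Q := by positivity
    linarith
  set S : ℝ := sSup ((fun t => ∫ x in B, |u x t| ^ σ) '' Icc (0 : ℝ) T) with hS
  have hSle : ∀ t ∈ Icc (0:ℝ) T, ∫ x in B, |u x t| ^ σ ≤ S := fun t ht =>
    le_csSup hbdd ⟨t, ht, rfl⟩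
  have hS0 : 0 ≤ S := by
    refine le_trans ?_ (hSle 0 ⟨le_rfl, hT.le⟩)
    exact integral_nonneg fun x => by positivity
  set D : Fin N → (Fin N → ℝ) × ℝ → ℝ := fun i p =>
    fderiv ℝ (fun y => |u y p.2| ^ (α i)) p.1 (Pi.single i 1) with hD
  have hvol : (volume : Measure ((Fin N → ℝ) × ℝ)).restrict (B ×ˢ Icc (0:ℝ) T) =
      (volume.restrict B).prod (volume.restrict (Icc (0:ℝ) T)) := by
    rw [Measure.prod_restrict]; rfl
  simp only [IntegrableOn] at hint
  rw [hvol] at hint ⊢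
  change ∀ i, Integrable (fun p => D i p ^ 2) _ at hint
  change _ ≤ _ * ∏ i, (∫ p, D i p ^ 2 ∂_) ^ r
  set μ := (volume : Measure (Fin N → ℝ)).restrict B with hμ
  set ν := (volume : Measure ℝ).restrict (Icc (0:ℝ) T) with hν
  set J : Fin N → ℝ := fun i => ∫ p, D i p ^ 2 ∂(μ.prod ν) with hJ
  have hJ0 : ∀ i, 0 ≤ J i := fun i => integral_nonneg fun x => by positivity
  have hRHS : 0 ≤ ((C ^ θ).toReal + 1) * T ^ k * S ^ (1 - θ) * ∏ i, J i ^ r := by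
    have : 0 ≤ ∏ i, J i ^ r := Finset.prod_nonneg fun i _ => Real.rpow_nonneg (hJ0 i) _
    positivity
  by_cases hLint : Integrable (fun p : (Fin N → ℝ) × ℝ => |u p.1 p.2| ^ q) (μ.prod ν)
  swap
  · rw [integral_undef hLint]; exact hRHS
  rw [← ENNReal.ofReal_le_ofReal_iff hRHS,
    ofReal_integral_eq_lintegral_ofReal hLint (Filter.Eventually.of_forall fun p => by positivity),
    lintegral_prod_symm _ hLint.aestronglyMeasurable.aemeasurable.ennreal_ofReal]
  set I : Fin N → ℝ → ENNReal := fun i t => ∫⁻ x, ENNReal.ofReal (D i (x, t) ^ 2) ∂μ with hI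
  have hDm : ∀ i, AEMeasurable (fun p => ENNReal.ofReal (D i p ^ 2)) (μ.prod ν) := fun i =>
    (hint i).aestronglyMeasurable.aemeasurable.ennreal_ofReal
  have hIJ : ∀ i, ∫⁻ t, I i t ∂ν = ENNReal.ofReal (J i) := by
    intro i
    rw [hJ, ofReal_integral_eq_lintegral_ofReal (hint i)
      (Filter.Eventually.of_forall fun p => by positivity), lintegral_prod_symm _ (hDm i)]
  have hIm : ∀ i, AEMeasurable (I i) ν := fun i =>
    (hDm i).prod_swap.lintegral_prod_right'
  have hIfin : ∀ᵐ t ∂ν, ∀ i, I i t < ⊤ := by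
    rw [ae_all_iff]
    intro i
    exact ae_lt_top' (hIm i) (by rw [hIJ]; simp)
  have hpt : ∀ᵐ t ∂ν, ∫⁻ x, ENNReal.ofReal (|u x t| ^ q) ∂μ ≤
      (C ^ θ * ENNReal.ofReal S ^ (1 - θ)) * ((1 : ENNReal) ^ k * ∏ i, I i t ^ r) := by
    filter_upwards [hIfin, ae_restrict_mem measurableSet_Icc] with t hfin ht
    obtain ⟨hsm, hcs, hsupp⟩ := hu t ht
    have hfull : ∀ i, ∫⁻ x, ENNReal.ofReal
        ((fderiv ℝ (fun y => |u y t| ^ (α i)) x (Pi.single i 1)) ^ 2) = I i t := by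
      intro i
      simp only [hI, hμ, hD]
      symm
      apply setLIntegral_eq_of_support_subset
      refine Subset.trans ?_ hsupp
      intro x hx
      by_contra hxs
      apply hx
      have hev : (fun y => |u y t| ^ (α i)) =ᶠ[nhds x] fun _ => 0 := by
        filter_upwards [notMem_tsupport_iff_eventuallyEq.mp hxs] with y hy
        have hy' : u y t = 0 := hy
        have := hα i
        rw [hy', abs_zero, Real.zero_rpow (by linarith)]
      simp only
      rw [hev.fderiv_eq]
      simp
    have hsl := hslice (fun x => u x t) (hsm.of_le (by exact_mod_cast le_top)) hcs
      (fun i => by rw [hfull]; exact (hfin i).ne)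
    simp_rw [hfull] at hsl
    have hcont : Continuous (fun x => u x t) := hsm.continuous
    have hms : ∀ s : ℝ, 0 ≤ s → Measurable (fun x => ENNReal.ofReal (|u x t| ^ s)) := fun s hs =>
      ((hcont.abs).rpow_const fun _ => Or.inr hs).measurable.ennreal_ofReal
    have hσS : ∫⁻ x, ENNReal.ofReal (|u x t| ^ σ) ∂μ ≤ ENNReal.ofReal S := by
      rw [← ofReal_integral_eq_lintegral_ofReal
        ((aux_cont N (fun x => u x t) hcont hcs σ (by linarith)).restrict)
        (Filter.Eventually.of_forall fun p => by positivity)]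
      exact ENNReal.ofReal_le_ofReal (hSle t ht)
    calc ∫⁻ x, ENNReal.ofReal (|u x t| ^ q) ∂μ
        = ∫⁻ x, ENNReal.ofReal (|u x t| ^ Q) ^ θ * ENNReal.ofReal (|u x t| ^ σ) ^ (1 - θ) ∂μ := by
          apply lintegral_congr
          intro x
          rw [ENNReal.ofReal_rpow_of_nonneg (by positivity) hθ0,
            ENNReal.ofReal_rpow_of_nonneg (by positivity) (by linarith),
            ← ENNReal.ofReal_mul (by positivity), ← Real.rpow_mul (abs_nonneg _),
            ← Real.rpow_mul (abs_nonneg _), ← Real.rpow_add_of_nonneg (abs_nonneg _)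
              (by positivity) (mul_nonneg (by linarith) (by linarith)), hq, mul_comm θ Q]
      _ ≤ (∫⁻ x, ENNReal.ofReal (|u x t| ^ Q) ∂μ) ^ θ *
          (∫⁻ x, ENNReal.ofReal (|u x t| ^ σ) ∂μ) ^ (1 - θ) := by
          apply ENNReal.lintegral_mul_norm_pow_le
          · exact (hms Q hQ0.le).aemeasurable
          · exact (hms σ (by linarith)).aemeasurable
          · exact hθ0
          · linarith
          · ring
      _ ≤ (C * ∏ i, I i t ^ (1 / ((N:ℝ) - 2))) ^ θ * ENNReal.ofReal S ^ (1 - θ) := by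
          apply mul_le_mul'
          · exact ENNReal.rpow_le_rpow ((setLIntegral_le_lintegral _ _).trans hsl) hθ0
          · exact ENNReal.rpow_le_rpow hσS (by linarith)
      _ = _ := by
          rw [ENNReal.mul_rpow_of_nonneg _ _ hθ0, ← ENNReal.prod_rpow_of_nonneg hθ0,
            ENNReal.one_rpow, one_mul]
          have : ∀ i, (I i t ^ (1 / ((N:ℝ) - 2))) ^ θ = I i t ^ r := fun i => by
            rw [← ENNReal.rpow_mul, hr]; congr 1; ring
          simp_rw [this]
          ring
  have hνT : ∫⁻ _, (1 : ENNReal) ∂ν = ENNReal.ofReal T := by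
    simp [hν]
  calc _ ≤ ∫⁻ t, (C ^ θ * ENNReal.ofReal S ^ (1 - θ)) * ((1 : ENNReal) ^ k * ∏ i, I i t ^ r) ∂ν :=
        lintegral_mono_ae hpt
    _ = (C ^ θ * ENNReal.ofReal S ^ (1 - θ)) * ∫⁻ t, ((1 : ENNReal) ^ k * ∏ i, I i t ^ r) ∂ν := by
        apply lintegral_const_mul'
        exact ENNReal.mul_ne_top hCθ (ENNReal.rpow_ne_top_of_nonneg (by linarith) (by simp))
    _ ≤ (C ^ θ * ENNReal.ofReal S ^ (1 - θ)) *
          ((∫⁻ _, (1 : ENNReal) ∂ν) ^ k * ∏ i, (∫⁻ t, I i t ∂ν) ^ r) := by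
        gcongr
        apply ENNReal.lintegral_mul_prod_norm_pow_le (g := fun _ => 1) (p := fun _ => r)
        · exact aemeasurable_const
        · exact fun i _ => hIm i
        · simp only [Finset.sum_const, Finset.card_univ, Fintype.card_fin, nsmul_eq_mul]
          rw [hk, hr]; field_simp; ring
        · exact hk0
        · exact fun _ _ => hr0
    _ = ENNReal.ofReal ((C ^ θ).toReal * T ^ k * S ^ (1 - θ) * ∏ i, J i ^ r) := by
        simp_rw [hνT, hIJ]
        rw [ENNReal.ofReal_mul (by positivity), ENNReal.ofReal_mul (by positivity),
          ENNReal.ofReal_mul (by positivity), ENNReal.ofReal_toReal hCθ,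
          ENNReal.ofReal_prod_of_nonneg (fun i _ => Real.rpow_nonneg (hJ0 i) _),
          ENNReal.ofReal_rpow_of_nonneg hS0 (by linarith),
          ENNReal.ofReal_rpow_of_nonneg hT.le hk0]
        have : ∀ i, ENNReal.ofReal (J i) ^ r = ENNReal.ofReal (J i ^ r) := fun i =>
          ENNReal.ofReal_rpow_of_nonneg (hJ0 i) hr0
        simp_rw [this]
        ring
    _ ≤ _ := by
        apply ENNReal.ofReal_le_ofReal
        have : 0 ≤ ∏ i, J i ^ r := Finset.prod_nonneg fun i _ => Real.rpow_nonneg (hJ0 i) _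
        gcongr
        linarith
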